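/- arXiv:2210.00994 — 4 statements merged into one kernel-verified Lean document; each statement's English description precedes it below -/
import Mathlib

section
/- For every real a with 0 < a < 1, the function t ↦ x_a(t) = ∫_a^t ((x/(x² + t − t²))² − 1)^{−1/2} dx is twice differentiable at t = 1, and its second derivative at t = 1 equals h(a) = log((1 + √(1 − a²))/a) + (a² − 2)/(1 − a²)^{3/2}; that is, the derivative function t ↦ x_a′(t) (defined for t near 1) has derivative h(a) at t = 1. -/
/-- `h(a) = log((1+√(1−a²))/a) + (a²−2)/(1−a²)^{3/2}`. -/
noncomputable def hFun (a : ℝ) : ℝ :=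
  Real.log ((1 + Real.sqrt (1 - a ^ 2)) / a) + (a ^ 2 - 2) / (1 - a ^ 2) ^ ((3:ℝ) / 2)

open Set Filter Topology MeasureTheory

lemma leibniz (H H' : ℝ → ℝ → ℝ) (b : ℝ → ℝ) (b' t0 p q c : ℝ)
    (ht0 : t0 ∈ Ioo p q) (hb0 : b t0 ∈ Ioo 0 c) (hb : HasDerivAt b b' t0)
    (hd : ∀ t ∈ Ioo p q, ∀ u ∈ Ioo (-c) c, HasDerivAt (fun s => H s u) (H' t u) t)
    (hc : ContinuousOn (Function.uncurry H) (Ioo p q ×ˢ Ioo (-c) c))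
    (hc' : ContinuousOn (Function.uncurry H') (Ioo p q ×ˢ Ioo (-c) c)) :
    HasDerivAt (fun t => ∫ u in (0:ℝ)..b t, H t u)
      (H t0 (b t0) * b' + ∫ u in (0:ℝ)..b t0, H' t0 u) t0 := by
  have hcpos : 0 < c := hb0.1.trans hb0.2
  have hU : IsOpen (Ioo p q ×ˢ Ioo (-c) c) := isOpen_Ioo.prod isOpen_Ioo
  have hslice : ∀ (K : ℝ → ℝ → ℝ), ContinuousOn (Function.uncurry K) (Ioo p q ×ˢ Ioo (-c) c) →
      ∀ t ∈ Ioo p q, ContinuousOn (K t) (Ioo (-c) c) := by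
    intro K hK t ht
    exact hK.comp (f := fun u => (t, u)) (by fun_prop) (fun u hu => ⟨ht, hu⟩)
  have hii : ∀ (K : ℝ → ℝ → ℝ), ContinuousOn (Function.uncurry K) (Ioo p q ×ˢ Ioo (-c) c) →
      ∀ t ∈ Ioo p q, ∀ x ∈ Ioo (-c) c, ∀ y ∈ Ioo (-c) c, IntervalIntegrable (K t) volume x y := by
    intro K hK t ht x hx y hy
    apply ContinuousOn.intervalIntegrable
    exact (hslice K hK t ht).mono (ordConnected_Ioo.uIcc_subset hx hy)
  have h0 : (0:ℝ) ∈ Ioo (-c) c := ⟨by linarith, hcpos⟩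
  have hb0' : b t0 ∈ Ioo (-c) c := ⟨by linarith [hb0.1], hb0.2⟩
  -- first part
  have h1 : HasDerivAt (fun t => ∫ u in (0:ℝ)..b t0, H t u) (∫ u in (0:ℝ)..b t0, H' t0 u) t0 := by
    obtain ⟨ε, hε, hεs⟩ : ∃ ε > 0, Icc (t0 - ε) (t0 + ε) ⊆ Ioo p q := by
      refine ⟨min (t0 - p) (q - t0) / 2, ?_, ?_⟩
      · have := ht0.1; have := ht0.2
        have : 0 < min (t0 - p) (q - t0) := lt_min (by linarith) (by linarith)
        linarith
      · intro x hx
        have h1 := min_le_left (t0 - p) (q - t0)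
        have h2 := min_le_right (t0 - p) (q - t0)
        have := ht0.1; have := ht0.2
        constructor <;> linarith [hx.1, hx.2]
    have hcomp : IsCompact (Icc (t0 - ε) (t0 + ε) ×ˢ Icc 0 (b t0)) := isCompact_Icc.prod isCompact_Icc
    have hsub : Icc (t0 - ε) (t0 + ε) ×ˢ Icc 0 (b t0) ⊆ Ioo p q ×ˢ Ioo (-c) c :=
      prod_mono hεs (fun x hx => ⟨by linarith [hx.1], by linarith [hx.2, hb0.2]⟩)
    obtain ⟨C, hC⟩ := hcomp.exists_bound_of_continuousOn (hc'.mono hsub)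
    have hio : uIoc (0:ℝ) (b t0) = Ioc 0 (b t0) := uIoc_of_le hb0.1.le
    refine (intervalIntegral.hasDerivAt_integral_of_dominated_loc_of_deriv_le
      (F := H) (F' := H') (bound := fun _ => C) (s := Icc (t0 - ε) (t0 + ε)) (μ := volume)
      (Icc_mem_nhds (by linarith) (by linarith)) ?_ (hii H hc t0 ht0 _ h0 _ hb0')
      ?_ ?_ ?_ ?_).2
    · filter_upwards [isOpen_Ioo.mem_nhds ht0] with t ht
      have := (hii H hc t ht _ h0 _ hb0').def'
      exact this.aestronglyMeasurable
    · exact (hii H' hc' t0 ht0 _ h0 _ hb0').def'.aestronglyMeasurable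
    · refine Eventually.of_forall fun u hu t ht => ?_
      rw [hio] at hu
      exact hC (t, u) ⟨ht, hu.1.le, hu.2⟩
    · exact intervalIntegrable_const
    · refine Eventually.of_forall fun u hu t ht => ?_
      rw [hio] at hu
      exact hd t (hεs ht) u ⟨by linarith [hu.1], by linarith [hu.2, hb0.2]⟩
  have h2 : HasDerivAt (fun t => ∫ u in b t0..b t, H t u) (H t0 (b t0) * b') t0 := by
    have h3 : HasDerivAt (fun t => H t0 (b t0) * (b t - b t0)) (H t0 (b t0) * b') t0 :=
      (hb.sub_const _).const_mul _
    have h4 : HasDerivAt (fun t => (∫ u in b t0..b t, H t u) - H t0 (b t0) * (b t - b t0)) 0 t0 := by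
      rw [hasDerivAt_iff_isLittleO]
      have hO := hb.isBigO_sub
      refine Asymptotics.IsLittleO.trans_isBigO (g := fun t => b t - b t0) ?_ hO
      rw [Asymptotics.isLittleO_iff]
      intro e he
      have hcont := hc.continuousAt (hU.mem_nhds (show (t0, b t0) ∈ Ioo p q ×ˢ Ioo (-c) c from ⟨ht0, hb0'⟩))
      rw [Metric.continuousAt_iff] at hcont
      obtain ⟨d, hdpos, hdd⟩ := hcont e he
      have e1 : ∀ᶠ t in 𝓝 t0, b t ∈ Ioo (-c) c := hb.continuousAt (isOpen_Ioo.mem_nhds hb0')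
      have e2 : ∀ᶠ t in 𝓝 t0, b t ∈ Metric.ball (b t0) d := hb.continuousAt (Metric.ball_mem_nhds _ hdpos)
      filter_upwards [isOpen_Ioo.mem_nhds ht0, e1, e2, Metric.ball_mem_nhds t0 hdpos] with t ht ht1 ht2 ht3
      simp only [intervalIntegral.integral_same, sub_self, mul_zero, sub_zero, smul_zero]
      have : (∫ u in b t0..b t, H t u) - H t0 (b t0) * (b t - b t0)
          = ∫ u in b t0..b t, (H t u - H t0 (b t0)) := by
        rw [intervalIntegral.integral_sub (hii H hc t ht _ hb0' _ ht1) intervalIntegrable_const]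
        simp [mul_comm]
      rw [this]
      refine intervalIntegral.norm_integral_le_of_norm_le_const ?_
      intro u hu
      have hu' : u ∈ Metric.ball (b t0) d := by
        have : uIcc (b t0) (b t) ⊆ Metric.ball (b t0) d := by
          rw [Real.ball_eq_Ioo] at ht2 ⊢
          exact ordConnected_Ioo.uIcc_subset ⟨by linarith, by linarith⟩ ht2
        exact this (uIoc_subset_uIcc hu)
      have := @hdd (t, u) (by
        rw [Prod.dist_eq]; exact max_lt ht3 hu')
      rw [Real.dist_eq] at this
      exact this.le
    have := h4.add h3
    simpa using this.congr_of_eventuallyEq (Eventually.of_forall fun t => by simp)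
  have h5 := h2.add h1
  refine h5.congr_of_eventuallyEq ?_
  have e1 : ∀ᶠ t in 𝓝 t0, b t ∈ Ioo (-c) c := hb.continuousAt (isOpen_Ioo.mem_nhds hb0')
  filter_upwards [isOpen_Ioo.mem_nhds ht0, e1] with t ht ht1
  simp only [Pi.add_apply]
  rw [add_comm, intervalIntegral.integral_add_adjacent_intervals (hii H hc t ht _ h0 _ hb0')
    (hii H hc t ht _ hb0' _ ht1)]

noncomputable def FF (t u : ℝ) : ℝ := (t - u^2) / (√(t^2 - u^2) * √(2*t - 1 - u^2))
noncomputable def LL (t u : ℝ) : ℝ := 1/(t - u^2) - t/(t^2-u^2) - 1/(2*t-1-u^2)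
noncomputable def LL' (t u : ℝ) : ℝ := -1/(t - u^2)^2 - 1/(t^2-u^2) + 2*t^2/(t^2-u^2)^2 + 2/(2*t-1-u^2)^2

lemma hasDerivAt_FF (t u : ℝ) (h1 : 0 < t - u^2) (h2 : 0 < t^2 - u^2) (h3 : 0 < 2*t-1-u^2) :
    HasDerivAt (fun s => FF s u) (FF t u * LL t u) t := by
  unfold FF
  have d1 : HasDerivAt (fun s : ℝ => s - u^2) 1 t := (hasDerivAt_id t).sub_const _
  have d2 : HasDerivAt (fun s : ℝ => s^2 - u^2) (2*t) t := by
    simpa using (hasDerivAt_pow 2 t).sub_const (u^2)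
  have d3 : HasDerivAt (fun s : ℝ => 2*s - 1 - u^2) 2 t := by
    simpa using (((hasDerivAt_id t).const_mul 2).sub_const 1).sub_const (u^2)
  have s2 := Real.sqrt_pos.2 h2
  have s3 := Real.sqrt_pos.2 h3
  have := d1.div ((d2.sqrt h2.ne').mul (d3.sqrt h3.ne')) (mul_pos s2 s3).ne'
  refine this.congr_deriv ?_
  unfold LL
  have q2 := Real.sq_sqrt h2.le
  have q3 := Real.sq_sqrt h3.le
  simp only [Pi.mul_apply]
  rw [show t/(t^2-u^2) = t / (√(t^2 - u^2))^2 by rw [q2],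
    show 1/(2*t-1-u^2) = 1 / (√(2*t-1-u^2))^2 by rw [q3]]
  generalize √(t^2 - u^2) = A at *
  generalize √(2*t-1-u^2) = B at *
  have := h1.ne'
  field_simp
  ring

lemma hasDerivAt_LL (t u : ℝ) (h1 : 0 < t - u^2) (h2 : 0 < t^2 - u^2) (h3 : 0 < 2*t-1-u^2) :
    HasDerivAt (fun s => LL s u) (LL' t u) t := by
  unfold LL
  have d1 : HasDerivAt (fun s : ℝ => s - u^2) 1 t := (hasDerivAt_id t).sub_const _
  have d2 : HasDerivAt (fun s : ℝ => s^2 - u^2) (2*t) t := by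
    simpa using (hasDerivAt_pow 2 t).sub_const (u^2)
  have d3 : HasDerivAt (fun s : ℝ => 2*s - 1 - u^2) 2 t := by
    simpa using (((hasDerivAt_id t).const_mul 2).sub_const 1).sub_const (u^2)
  have := (((hasDerivAt_const t (1:ℝ)).div d1 h1.ne').sub ((hasDerivAt_id t).div d2 h2.ne')).sub
    ((hasDerivAt_const t (1:ℝ)).div d3 h3.ne')
  refine this.congr_deriv ?_
  unfold LL'
  have := h1.ne'; have := h2.ne'; have := h3.ne'
  simp only [id]
  generalize t - u^2 = A at *
  generalize 2*t-1-u^2 = B at *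
  generalize t^2-u^2 = C at *
  field_simp
  ring

lemma hasDerivAt_FL (t u : ℝ) (h1 : 0 < t - u^2) (h2 : 0 < t^2 - u^2) (h3 : 0 < 2*t-1-u^2) :
    HasDerivAt (fun s => FF s u * LL s u) (FF t u * (LL' t u + LL t u ^ 2)) t := by
  refine ((hasDerivAt_FF t u h1 h2 h3).mul (hasDerivAt_LL t u h1 h2 h3)).congr_deriv ?_
  ring

lemma cont_FF (U : Set (ℝ × ℝ)) (hU : ∀ z ∈ U, 0 < z.1 - z.2^2 ∧ 0 < z.1^2 - z.2^2 ∧ 0 < 2*z.1-1-z.2^2) :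
    ContinuousOn (fun z : ℝ × ℝ => FF z.1 z.2) U ∧ ContinuousOn (fun z : ℝ × ℝ => LL z.1 z.2) U ∧
    ContinuousOn (fun z : ℝ × ℝ => LL' z.1 z.2) U := by
  have h1 : ∀ z ∈ U, z.1 - z.2^2 ≠ 0 := fun z hz => (hU z hz).1.ne'
  have h2 : ∀ z ∈ U, z.1^2 - z.2^2 ≠ 0 := fun z hz => (hU z hz).2.1.ne'
  have h3 : ∀ z ∈ U, 2*z.1-1-z.2^2 ≠ 0 := fun z hz => (hU z hz).2.2.ne'
  refine ⟨?_, ?_, ?_⟩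
  · unfold FF
    refine ContinuousOn.div (by fun_prop) (by fun_prop) fun z hz => ?_
    exact (mul_pos (Real.sqrt_pos.2 (hU z hz).2.1) (Real.sqrt_pos.2 (hU z hz).2.2)).ne'
  · unfold LL
    exact ((ContinuousOn.div (by fun_prop) (by fun_prop) h1).sub
      (ContinuousOn.div (by fun_prop) (by fun_prop) h2)).sub
      (ContinuousOn.div (by fun_prop) (by fun_prop) h3)
  · unfold LL'
    exact (((ContinuousOn.div (by fun_prop) (by fun_prop) (fun z hz => pow_ne_zero 2 (h1 z hz))).sub
      (ContinuousOn.div (by fun_prop) (by fun_prop) h2)).add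
      (ContinuousOn.div (by fun_prop) (by fun_prop) (fun z hz => pow_ne_zero 2 (h2 z hz)))).add
      (ContinuousOn.div (by fun_prop) (by fun_prop) (fun z hz => pow_ne_zero 2 (h3 z hz)))

/-- substitution -/
lemma subst_xa (a t : ℝ) (ha : 0 < a) (hat : a < t) (h1 : (1-t)^2 < a^2) (h2 : t^2 - t < a^2) :
    (∫ x in a..t, 1 / Real.sqrt ((x / (x ^ 2 + t - t ^ 2)) ^ 2 - 1))
      = ∫ u in (0:ℝ)..√(t^2 - a^2), FF t u := by
  have hB : 0 < t^2 - a^2 := by nlinarith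
  have hb := Real.sqrt_pos.2 hB
  have hbs := Real.sq_sqrt hB.le
  set b := √(t^2 - a^2) with hbdef
  rw [intervalIntegral.integral_of_le hat.le, intervalIntegral.integral_of_le hb.le,
    integral_Ioc_eq_integral_Ioo, integral_Ioc_eq_integral_Ioo]
  have him : (fun u => √(t^2 - u^2)) '' Ioo 0 b = Ioo a t := by
    ext x
    constructor
    · rintro ⟨u, ⟨hu0, hub⟩, rfl⟩
      constructor
      · apply Real.lt_sqrt_of_sq_lt; nlinarith
      · rw [Real.sqrt_lt' (by linarith)]; nlinarith
    · rintro ⟨hx1, hx2⟩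
      have hx : 0 < t^2 - x^2 := by nlinarith
      refine ⟨√(t^2-x^2), ⟨Real.sqrt_pos.2 hx, Real.sqrt_lt_sqrt hx.le (by nlinarith)⟩, ?_⟩
      simp only
      rw [Real.sq_sqrt hx.le, show t^2 - (t^2 - x^2) = x^2 by ring, Real.sqrt_sq (by linarith)]
  have hpos : ∀ u ∈ Ioo 0 b, 0 < t^2 - u^2 := fun u hu => by nlinarith [hu.1, hu.2]
  have hder : ∀ u ∈ Ioo 0 b, HasDerivWithinAt (fun u => √(t^2 - u^2)) (-u/√(t^2-u^2)) (Ioo 0 b) u := by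
    intro u hu
    have d2 : HasDerivAt (fun s : ℝ => t^2 - s^2) (-(2*u)) u := by
      simpa using (hasDerivAt_pow 2 u).const_sub (t^2)
    refine ((d2.sqrt (hpos u hu).ne').congr_deriv ?_).hasDerivWithinAt
    have := Real.sqrt_pos.2 (hpos u hu)
    field_simp
  have hinj : InjOn (fun u => √(t^2 - u^2)) (Ioo 0 b) := by
    intro u hu v hv h
    simp only at h
    rw [Real.sqrt_inj (hpos u hu).le (hpos v hv).le] at h
    have : u^2 = v^2 := by linarith
    exact (pow_left_inj₀ hu.1.le hv.1.le two_ne_zero).1 this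
  rw [← him, integral_image_eq_integral_abs_deriv_smul measurableSet_Ioo hder hinj]
  refine setIntegral_congr_fun measurableSet_Ioo fun u hu => ?_
  have hp := hpos u hu
  have hs := Real.sqrt_pos.2 hp
  have hu0 := hu.1
  have hub : u^2 < b^2 := by nlinarith [hu.1, hu.2]
  have p1 : 0 < t - u^2 := by linarith
  have p3 : 0 < 2*t-1-u^2 := by nlinarith
  have hs3 := Real.sqrt_pos.2 p3
  simp only [smul_eq_mul]
  rw [Real.sq_sqrt hp.le, show t^2 - u^2 + t - t^2 = t - u^2 by ring, div_pow, Real.sq_sqrt hp.le,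
    show (t^2-u^2)/(t-u^2)^2 - 1 = (u/(t-u^2))^2 * (2*t-1-u^2) by field_simp; ring,
    Real.sqrt_mul (sq_nonneg _), Real.sqrt_sq (by positivity), abs_div, abs_neg, abs_of_pos hu0,
    abs_of_pos hs]
  unfold FF
  field_simp

lemma FF_one (u : ℝ) (h : u^2 < 1) : FF 1 u = 1 := by
  unfold FF
  have : 0 < 1 - u^2 := by linarith
  rw [show (1:ℝ)^2 - u^2 = 1 - u^2 by ring, show (2:ℝ)*1-1-u^2 = 1-u^2 by ring,
    Real.mul_self_sqrt this.le, div_self this.ne']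

lemma int_F2 (a : ℝ) (ha : 0 < a) (ha1 : a < 1) :
    ∫ u in (0:ℝ)..√(1 - a^2), FF 1 u * (LL' 1 u + LL 1 u ^ 2)
      = 2 * √(1 - a^2) / a^2 + Real.log ((1 + √(1 - a^2)) / a) := by
  have hB : 0 < 1 - a^2 := by nlinarith
  have hb := Real.sqrt_pos.2 hB
  have hbs := Real.sq_sqrt hB.le
  set b := √(1 - a^2) with hbdef
  have hmem : ∀ u ∈ uIcc 0 b, 0 ≤ u ∧ 0 < 1 - u^2 := by
    intro u hu
    rw [uIcc_of_le hb.le] at hu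
    exact ⟨hu.1, by nlinarith [hu.1, hu.2]⟩
  have hval : ∀ u ∈ uIcc 0 b, FF 1 u * (LL' 1 u + LL 1 u ^ 2) = 4/(1-u^2)^2 - 1/(1-u^2) := by
    intro u hu
    have h := (hmem u hu).2
    rw [FF_one u (by linarith)]
    unfold LL LL'
    rw [show (1:ℝ)^2 - u^2 = 1 - u^2 by ring, show (2:ℝ)*1-1-u^2 = 1-u^2 by ring]
    field_simp
    ring
  rw [intervalIntegral.integral_congr hval]
  have hd : ∀ u ∈ uIcc 0 b, HasDerivAt (fun u => 2*u/(1-u^2) + (Real.log (1+u) - Real.log (1-u^2)/2))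
      (4/(1-u^2)^2 - 1/(1-u^2)) u := by
    intro u hu
    have ⟨h0, h⟩ := hmem u hu
    have d2 : HasDerivAt (fun s : ℝ => 1 - s^2) (-(2*u)) u := by
      simpa using (hasDerivAt_pow 2 u).const_sub 1
    have d1 : HasDerivAt (fun s : ℝ => 2 * s) 2 u := by simpa using (hasDerivAt_id u).const_mul 2
    have d3 : HasDerivAt (fun s : ℝ => 1 + s) 1 u := (hasDerivAt_id u).const_add 1
    refine ((d1.div d2 h.ne').add ((d3.log (by linarith)).sub ((d2.log h.ne').div_const 2))).congr_deriv ?_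
    have h1 : 1 + u ≠ 0 := by linarith
    have h2 : 1 - u ≠ 0 := by intro hh; nlinarith
    rw [show 1 - u^2 = (1+u)*(1-u) by ring]
    field_simp
    ring
  rw [intervalIntegral.integral_eq_sub_of_hasDerivAt hd]
  · rw [hbs, show 1 - (1 - a^2) = a^2 by ring, Real.log_div (by linarith) ha.ne', Real.log_pow]
    norm_num
  · apply ContinuousOn.intervalIntegrable
    have h : ∀ u ∈ uIcc 0 b, 1 - u^2 ≠ 0 := fun u hu => (hmem u hu).2.ne'
    exact (ContinuousOn.div (by fun_prop) (by fun_prop) (fun z hz => pow_ne_zero 2 (h z hz))).sub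
      (ContinuousOn.div (by fun_prop) (by fun_prop) h)

theorem xa_second_deriv_at_one (a : ℝ) (ha0 : 0 < a) (ha1 : a < 1) :
    HasDerivAt
      (deriv (fun t => ∫ x in a..t, 1 / Real.sqrt ((x / (x ^ 2 + t - t ^ 2)) ^ 2 - 1)))
      (hFun a) 1 := by
  obtain ⟨δ, hδ, hδ1, hδ2⟩ : ∃ δ > 0, δ ≤ a^2/8 ∧ δ ≤ (1-a)/2 :=
    ⟨min (a^2/8) ((1-a)/2), lt_min (by positivity) (by linarith), min_le_left _ _, min_le_right _ _⟩
  have hasq : a^2 < 1 := by nlinarith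
  have hcc : 0 < 1 - a^2/2 := by linarith
  obtain ⟨c, hc0, hc2⟩ : ∃ c > 0, c^2 = 1 - a^2/2 :=
    ⟨√(1 - a^2/2), Real.sqrt_pos.2 hcc, Real.sq_sqrt hcc.le⟩
  have hbox : ∀ t ∈ Ioo (1-δ) (1+δ), ∀ u ∈ Ioo (-c) c,
      0 < t - u^2 ∧ 0 < t^2 - u^2 ∧ 0 < 2*t-1-u^2 := by
    intro t ht u hu
    have hu2 : u^2 < c^2 := by nlinarith [hu.1, hu.2]
    have h3 : 0 < 2*t-1-u^2 := by linarith [ht.1]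
    exact ⟨by linarith [ht.1], by nlinarith [sq_nonneg (t-1)], h3⟩
  have hbox' : ∀ z ∈ Ioo (1-δ) (1+δ) ×ˢ Ioo (-c) c,
      0 < z.1 - z.2^2 ∧ 0 < z.1^2 - z.2^2 ∧ 0 < 2*z.1-1-z.2^2 :=
    fun z hz => hbox z.1 hz.1 z.2 hz.2
  obtain ⟨cF, cL, cL'⟩ := cont_FF _ hbox'
  have hat : ∀ t ∈ Ioo (1-δ) (1+δ), a < t := fun t ht => by linarith [ht.1]
  have hBp : ∀ t ∈ Ioo (1-δ) (1+δ), 0 < t^2 - a^2 := fun t ht => by nlinarith [hat t ht]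
  have hbm : ∀ t ∈ Ioo (1-δ) (1+δ), √(t^2 - a^2) ∈ Ioo 0 c := by
    intro t ht
    refine ⟨Real.sqrt_pos.2 (hBp t ht), ?_⟩
    rw [Real.sqrt_lt' hc0, hc2]
    nlinarith [ht.1, ht.2]
  have hbd : ∀ t ∈ Ioo (1-δ) (1+δ), HasDerivAt (fun t => √(t^2 - a^2)) (t/√(t^2 - a^2)) t := by
    intro t ht
    have d2 : HasDerivAt (fun s : ℝ => s^2 - a^2) (2*t) t := by
      simpa using (hasDerivAt_pow 2 t).sub_const (a^2)
    refine (d2.sqrt (hBp t ht).ne').congr_deriv ?_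
    have := (hbm t ht).1
    field_simp
  have h1m : (1:ℝ) ∈ Ioo (1-δ) (1+δ) := ⟨by linarith, by linarith⟩
  have hnh : Ioo (1-δ) (1+δ) ∈ 𝓝 (1:ℝ) := isOpen_Ioo.mem_nhds h1m
  -- first derivative
  have hG : ∀ t ∈ Ioo (1-δ) (1+δ),
      deriv (fun t => ∫ x in a..t, 1 / Real.sqrt ((x / (x ^ 2 + t - t ^ 2)) ^ 2 - 1)) t
      = (t - t^2 + a^2) / (a * √(2*t-1-t^2+a^2)) * (t/√(t^2 - a^2))
        + ∫ u in (0:ℝ)..√(t^2 - a^2), FF t u * LL t u := by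
    intro t ht
    have h := leibniz FF (fun t u => FF t u * LL t u) (fun t => √(t^2 - a^2)) _ t (1-δ) (1+δ) c ht
      (hbm t ht) (hbd t ht)
      (fun t ht u hu => hasDerivAt_FF t u (hbox t ht u hu).1 (hbox t ht u hu).2.1 (hbox t ht u hu).2.2)
      cF (cF.mul cL)
    have h' := (h.congr_of_eventuallyEq (f₁ := fun t => ∫ x in a..t, 1 / Real.sqrt ((x / (x ^ 2 + t - t ^ 2)) ^ 2 - 1)) (by
      filter_upwards [isOpen_Ioo.mem_nhds ht] with s hs
      exact subst_xa a s ha0 (hat s hs) (by nlinarith [hs.1, hs.2]) (by nlinarith [hs.1, hs.2]))).deriv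
    rw [h']
    congr 2
    unfold FF
    rw [Real.sq_sqrt (hBp t ht).le, show t^2 - (t^2 - a^2) = a^2 by ring, Real.sqrt_sq ha0.le]
    congr 1
    · ring
    · congr 2
      ring
  have hint := leibniz (fun t u => FF t u * LL t u) (fun t u => FF t u * (LL' t u + LL t u ^ 2))
      (fun t => √(t^2 - a^2)) _ 1 (1-δ) (1+δ) c h1m
      (hbm 1 h1m) (hbd 1 h1m)
      (fun t ht u hu => hasDerivAt_FL t u (hbox t ht u hu).1 (hbox t ht u hu).2.1 (hbox t ht u hu).2.2)
      (cF.mul cL) (cF.mul (cL'.add (cL.pow 2)))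
  have hB : 0 < 1 - a^2 := by linarith
  have hb := Real.sqrt_pos.2 hB
  have hbs := Real.sq_sqrt hB.le
  simp only [one_pow] at hint
  rw [int_F2 a ha0 ha1, FF_one _ (by rw [hbs]; nlinarith)] at hint
  have hbd1 := hbd 1 h1m
  have hn : HasDerivAt (fun t : ℝ => t - t^2 + a^2) (-1) 1 := by
    have := ((hasDerivAt_id (1:ℝ)).sub (hasDerivAt_pow 2 (1:ℝ))).add_const (a^2)
    refine this.congr_deriv ?_
    norm_num
  have hm : HasDerivAt (fun t : ℝ => 2*t - 1 - t^2 + a^2) 0 1 := by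
    have := ((((hasDerivAt_id (1:ℝ)).const_mul 2).sub_const 1).sub (hasDerivAt_pow 2 (1:ℝ))).add_const (a^2)
    refine this.congr_deriv ?_
    norm_num
  have e1 : (2:ℝ)*1 - 1 - 1^2 + a^2 = a^2 := by ring
  have hq := hm.sqrt (by rw [e1]; positivity)
  have hne : a * √((2:ℝ)*1 - 1 - 1^2 + a^2) ≠ 0 := by
    rw [e1, Real.sqrt_sq ha0.le]; positivity
  have hT := (hn.div (hq.const_mul a) hne).mul ((hasDerivAt_id (1:ℝ)).div hbd1 (by simpa using hb.ne'))
  have hfin := hT.add hint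
  refine (hfin.congr_of_eventuallyEq ?_).congr_deriv ?_
  · filter_upwards [hnh] with t ht
    rw [hG t ht]
    rfl
  · unfold hFun
    have e3 : (1 - a^2) ^ ((3:ℝ)/2) = √(1-a^2)^3 := by
      rw [Real.sqrt_eq_rpow, ← Real.rpow_natCast ((1 - a^2) ^ ((1:ℝ)/2)) 3, ← Real.rpow_mul hB.le]
      norm_num
    rw [e3]
    have e4 : LL 1 √(1 - a^2) = -1/a^2 := by
      unfold LL
      rw [hbs, show (1:ℝ) - (1 - a^2) = a^2 by ring, show (1:ℝ)^2 - (1 - a^2) = a^2 by ring,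
        show (2:ℝ)*1 - 1 - (1 - a^2) = a^2 by ring]
      ring
    rw [e4]
    have e5 : √((2:ℝ)*1 - 1 - 1 + a^2) = a := by
      rw [show (2:ℝ)*1 - 1 - 1 + a^2 = a^2 by ring, Real.sqrt_sq ha0.le]
    simp only [Pi.div_apply, id, one_pow, e5]
    have ea : a^2 = 1 - √(1-a^2)^2 := by rw [hbs]; ring
    generalize Real.log _ = l
    generalize √(1-a^2) = b at *
    simp only [mul_zero, zero_div, sub_self, zero_add, sub_zero]
    have ha := ha0.ne'
    have hb' := hb.ne'
    field_simp
    first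
      | linear_combination (2*b^2 - a^2) * ea
      | linear_combination a * (2*b^2 - a^2) * ea
      | linear_combination a^2 * (2*b^2 - a^2) * ea
end

section
/- Let a₀ ∈ (0,1) be the unique zero of g(a) = −log((1 + √(1 − a²))/a) + 1/√(1 − a²). For every a with a₀ < a < 1 there exists η > 0 (with η < min(a, 1−a)) such that: x_a(t) < √(1 − a²) for all t with 1 − η ≤ t < 1, and x_a(t) > √(1 − a²) for all t with 1 < t ≤ 1 + η. -/
/-- `g(a) = −log((1+√(1−a²))/a) + 1/√(1−a²)`. -/
noncomputable def gFun (a : ℝ) : ℝ :=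
  -Real.log ((1 + Real.sqrt (1 - a ^ 2)) / a) + 1 / Real.sqrt (1 - a ^ 2)

/-- `x_a(t) = ∫_a^t ((x/(x²+t−t²))²−1)^{−1/2} dx`. -/
noncomputable def xaFun (a t : ℝ) : ℝ :=
  ∫ x in a..t, 1 / Real.sqrt ((x / (x ^ 2 + t - t ^ 2)) ^ 2 - 1)


noncomputable def LFun (s : ℝ) : ℝ := (Real.log (1 + s) - Real.log (1 - s)) / 2

lemma LFun_mono {s r : ℝ} (hs : 0 ≤ s) (h : s < r) (hr : r < 1) : LFun s < LFun r := by
  unfold LFun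
  have h1 := Real.log_lt_log (by linarith : 0 < 1 + s) (by linarith : 1 + s < 1 + r)
  have h2 := Real.log_lt_log (by linarith : 0 < 1 - r) (by linarith : 1 - r < 1 - s)
  linarith

lemma gFun_eq {a : ℝ} (h0 : 0 < a) (h1 : a < 1) :
    gFun a = 1 / Real.sqrt (1 - a ^ 2) - LFun (Real.sqrt (1 - a ^ 2)) := by
  have hp : 0 < 1 - a ^ 2 := by nlinarith
  have hs := Real.sq_sqrt hp.le
  have hs0 := Real.sqrt_pos.2 hp
  unfold gFun LFun
  set s := Real.sqrt (1 - a ^ 2)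
  have hs1 : s < 1 := by nlinarith
  have e : Real.log (a ^ 2) = Real.log (1 + s) + Real.log (1 - s) := by
    rw [← Real.log_mul (by linarith) (by linarith)]
    congr 1; linarith
  rw [Real.log_pow] at e
  rw [Real.log_div (by linarith) h0.ne']
  push_cast at e
  linarith

lemma key_pos {a₀ a : ℝ} (h₀ : a₀ ∈ Set.Ioo (0:ℝ) 1)
    (hz : gFun a₀ = 0) (ha : a₀ < a) (ha1 : a < 1) :
    LFun (Real.sqrt (1 - a ^ 2)) < 1 / Real.sqrt (1 - a ^ 2) := by
  obtain ⟨h0, h1⟩ := h₀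
  rw [gFun_eq h0 h1] at hz
  have hp : 0 < 1 - a ^ 2 := by nlinarith
  have hlt : Real.sqrt (1 - a ^ 2) < Real.sqrt (1 - a₀ ^ 2) :=
    Real.sqrt_lt_sqrt hp.le (by nlinarith)
  have hs0 := Real.sqrt_pos.2 hp
  have hr1 : Real.sqrt (1 - a₀ ^ 2) < 1 := by
    rw [Real.sqrt_lt' one_pos]; nlinarith
  have h2 := LFun_mono hs0.le hlt hr1
  have h3 := one_div_lt_one_div_of_lt hs0 hlt
  linarith

/-- the comparison primitive -/
noncomputable def HFun (t k x : ℝ) : ℝ :=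
  -Real.sqrt (t ^ 2 - x ^ 2) + k * LFun (Real.sqrt (t ^ 2 - x ^ 2))

lemma LFun_zero : LFun 0 = 0 := by simp [LFun]

lemma HFun_end (t k : ℝ) : HFun t k t = 0 := by simp [HFun, LFun_zero]

lemma LFun_deriv {s : ℝ} (h0 : 0 ≤ s) (h1 : s < 1) :
    HasDerivAt LFun (1 / (1 - s ^ 2)) s := by
  have e1 : HasDerivAt (fun s : ℝ => 1 + s) 1 s := (hasDerivAt_id s).const_add 1
  have e2 : HasDerivAt (fun s : ℝ => 1 - s) (-1) s := (hasDerivAt_id s).const_sub 1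
  have := ((e1.log (by linarith)).sub (e2.log (by linarith))).div_const 2
  refine this.congr_deriv ?_
  have a1 : 1 + s ≠ 0 := by linarith
  have a2 : 1 - s ≠ 0 := by linarith
  have a3 : 1 - s ^ 2 ≠ 0 := by nlinarith
  field_simp
  ring

lemma HFun_deriv {t k x : ℝ} (h0 : 0 < t ^ 2 - x ^ 2) (h1 : t ^ 2 - x ^ 2 < 1) :
    HasDerivAt (HFun t k) (x / Real.sqrt (t ^ 2 - x ^ 2) * (1 - k / (1 - (t ^ 2 - x ^ 2)))) x := by
  have hs : Real.sqrt (t ^ 2 - x ^ 2) < 1 := by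
    rw [Real.sqrt_lt' one_pos]; linarith
  have hs0 := Real.sqrt_pos.2 h0
  have e1 : HasDerivAt (fun x : ℝ => t ^ 2 - x ^ 2) (-(2 * x)) x := by
    simpa using (hasDerivAt_pow 2 x).const_sub (t ^ 2)
  have e2 := e1.sqrt h0.ne'
  have e3 := (LFun_deriv hs0.le hs).comp x e2
  refine (e2.neg.add (e3.const_mul k)).congr_deriv ?_
  rw [Real.sq_sqrt h0.le]
  have : 1 - (t ^ 2 - x ^ 2) ≠ 0 := by linarith
  field_simp
  ring

lemma HFun_cont {t k a : ℝ} (h0 : 0 < a) (h1 : t ^ 2 - a ^ 2 < 1) :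
    ContinuousOn (HFun t k) (Set.Icc a t) := by
  intro x hx
  have hs : Real.sqrt (t ^ 2 - x ^ 2) < 1 := by
    rw [Real.sqrt_lt' one_pos]; nlinarith [hx.1, hx.2]
  have c : ContinuousAt (fun x : ℝ => Real.sqrt (t ^ 2 - x ^ 2)) x := by fun_prop
  have c2 : ContinuousAt LFun (Real.sqrt (t ^ 2 - x ^ 2)) :=
    (LFun_deriv (Real.sqrt_nonneg _) hs).continuousAt
  have c3 : ContinuousAt (fun x => LFun (Real.sqrt (t ^ 2 - x ^ 2))) x :=
    ContinuousAt.comp (f := fun x : ℝ => Real.sqrt (t ^ 2 - x ^ 2)) c2 c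
  exact (c.neg.add (continuousAt_const.mul c3)).continuousWithinAt

/-- factor the integrand -/
lemma integrand_eq {t x : ℝ} (hx : 0 < x) (hxt : x < t) (hB : 0 < x ^ 2 - (1 - t) ^ 2)
    (hc : 0 < x ^ 2 + t - t ^ 2) :
    1 / Real.sqrt ((x / (x ^ 2 + t - t ^ 2)) ^ 2 - 1) =
      x / Real.sqrt (t ^ 2 - x ^ 2) *
        ((x ^ 2 + t - t ^ 2) / Real.sqrt (x ^ 2 * (x ^ 2 - (1 - t) ^ 2))) := by
  have hA : 0 < t ^ 2 - x ^ 2 := by nlinarith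
  have e : (x / (x ^ 2 + t - t ^ 2)) ^ 2 - 1 =
      (t ^ 2 - x ^ 2) * (x ^ 2 - (1 - t) ^ 2) / (x ^ 2 + t - t ^ 2) ^ 2 := by
    field_simp
    ring
  rw [e, Real.sqrt_div (by positivity), Real.sqrt_sq hc.le, Real.sqrt_mul hA.le,
    Real.sqrt_mul (by positivity), Real.sqrt_sq hx.le]
  have := Real.sqrt_pos.2 hA
  have := Real.sqrt_pos.2 hB
  field_simp

lemma F_lower {t x : ℝ} (ht : 1 < t) (hx : 0 < x) (hB : 0 < x ^ 2 - (1 - t) ^ 2)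
    (hc : 0 < x ^ 2 + t - t ^ 2) (hv : t ^ 2 - x ^ 2 < 1) :
    1 - ((t ^ 2 - 1) / 2) / (1 - (t ^ 2 - x ^ 2)) ≤
      (x ^ 2 + t - t ^ 2) / Real.sqrt (x ^ 2 * (x ^ 2 - (1 - t) ^ 2)) := by
  have hAB : 0 < x ^ 2 * (x ^ 2 - (1 - t) ^ 2) := by positivity
  have hk : 0 < (t ^ 2 - 1) / 2 := by nlinarith
  have h1 : Real.sqrt (x ^ 2 * (x ^ 2 - (1 - t) ^ 2)) ≤
      (x ^ 2 + t - t ^ 2) + (t ^ 2 - 1) / 2 := by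
    apply Real.sqrt_le_iff.2
    refine ⟨by linarith, ?_⟩
    nlinarith [sq_nonneg (x ^ 2 - (x ^ 2 - (1 - t) ^ 2))]
  have h2 : (x ^ 2 + t - t ^ 2) / ((x ^ 2 + t - t ^ 2) + (t ^ 2 - 1) / 2) ≤
      (x ^ 2 + t - t ^ 2) / Real.sqrt (x ^ 2 * (x ^ 2 - (1 - t) ^ 2)) :=
    div_le_div_of_nonneg_left hc.le (Real.sqrt_pos.2 hAB) h1
  refine le_trans ?_ h2
  set k := (t ^ 2 - 1) / 2 with hkd
  set w := 1 - (t ^ 2 - x ^ 2) with hw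
  have hw0 : 0 < w := by linarith
  have e : x ^ 2 + t - t ^ 2 = w + (t - 1) := by rw [hw]; ring
  rw [e] at hc ⊢
  rw [one_sub_div hw0.ne', div_le_div_iff₀ hw0 (by linarith)]
  nlinarith [mul_pos hk (sub_pos.2 ht)]

set_option maxHeartbeats 2000000 in
lemma F_upper {a t x : ℝ} (ha : 0 < a) (ht : t < 1) (ht0 : 0 < t) (hx : a ≤ x) (hxt : x < t)
    (hη : 1 - t ≤ a ^ 2 / 4) (hB : 0 < x ^ 2 - (1 - t) ^ 2) :
    (x ^ 2 + t - t ^ 2) / Real.sqrt (x ^ 2 * (x ^ 2 - (1 - t) ^ 2)) ≤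
    1 - (-((1 - t) * ((1 + (1 - t) / (2 * a ^ 2)) / (1 - 2 * (1 - t) / a ^ 2))))
        / (1 - (t ^ 2 - x ^ 2)) := by
  have hx0 : 0 < x := by linarith
  have hAB : 0 < x ^ 2 * (x ^ 2 - (1 - t) ^ 2) := by positivity
  have ha2 : 0 < a ^ 2 := by positivity
  have hax : a ^ 2 ≤ x ^ 2 := by nlinarith
  have htx : x ^ 2 < t ^ 2 := by nlinarith
  have he : 0 < 1 - t := by linarith
  have hd : 0 < 1 - 2 * (1 - t) / a ^ 2 := by
    rw [sub_pos, div_lt_one ha2]; linarith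
  set K := (1 + (1 - t) / (2 * a ^ 2)) / (1 - 2 * (1 - t) / a ^ 2) with hK
  have hK0 : 0 < K := by positivity
  set w := 1 - (t ^ 2 - x ^ 2) with hw
  have hw0 : 0 < w := by nlinarith
  have haw : a ^ 2 ≤ w := by nlinarith
  have e : 1 - (-((1 - t) * K)) / w = 1 + (1 - t) * (K / w) := by ring
  rw [e, div_le_iff₀ (Real.sqrt_pos.2 hAB)]
  have hR : 0 < 1 + (1 - t) * (K / w) := by positivity
  -- B lower bound
  have hBw : w * (1 - 2 * (1 - t) / a ^ 2) ≤ x ^ 2 - (1 - t) ^ 2 := by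
    have h1 : 2 * (1 - t) ≤ w * (2 * (1 - t) / a ^ 2) := by
      rw [mul_div_assoc', le_div_iff₀ ha2]; nlinarith
    have : x ^ 2 - (1 - t) ^ 2 = w - 2 * (1 - t) := by rw [hw]; ring
    rw [this]; linarith
  have hN : 2 * t ^ 2 - (t ^ 2 - x ^ 2) * (1 + t) ≤ 2 * x ^ 2 * (1 + (1 - t) / (2 * a ^ 2)) := by
    have h1 : (t ^ 2 - x ^ 2) * (1 - t) ≤ 2 * x ^ 2 * ((1 - t) / (2 * a ^ 2)) := by
      have : 2 * x ^ 2 * ((1 - t) / (2 * a ^ 2)) = x ^ 2 * (1 - t) / a ^ 2 := by field_simp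
      rw [this, le_div_iff₀ ha2]
      have : (t ^ 2 - x ^ 2) * a ^ 2 ≤ x ^ 2 := by nlinarith
      nlinarith
    nlinarith
  have hKe : K * (1 - 2 * (1 - t) / a ^ 2) = 1 + (1 - t) / (2 * a ^ 2) := by
    rw [hK, div_mul_cancel₀ _ hd.ne']
  have hmain : 2 * t ^ 2 - (t ^ 2 - x ^ 2) * (1 + t) ≤
      2 * (K / w) * (x ^ 2 * (x ^ 2 - (1 - t) ^ 2)) := by
    refine hN.trans ?_
    rw [← hKe]
    have : K * (1 - 2 * (1 - t) / a ^ 2) = K / w * (w * (1 - 2 * (1 - t) / a ^ 2)) := by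
      field_simp
    rw [this]
    have h3 := mul_le_mul_of_nonneg_left hBw (by positivity : 0 ≤ 2 * x ^ 2 * (K / w))
    nlinarith
  have hsq : (x ^ 2 + t - t ^ 2) ^ 2 ≤
      (1 + (1 - t) * (K / w)) ^ 2 * (x ^ 2 * (x ^ 2 - (1 - t) ^ 2)) := by
    have e1 : (x ^ 2 + t - t ^ 2) ^ 2 = x ^ 2 * (x ^ 2 - (1 - t) ^ 2) +
      (1 - t) * (2 * t ^ 2 - (t ^ 2 - x ^ 2) * (1 + t)) := by ring
    rw [e1]
    have h4 := mul_le_mul_of_nonneg_left hmain he.le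
    have h5 : 0 ≤ ((1 - t) * (K / w)) ^ 2 * (x ^ 2 * (x ^ 2 - (1 - t) ^ 2)) := by positivity
    nlinarith
  refine (sq_le_sq₀ (by nlinarith) (by positivity)).1 ?_
  rw [mul_pow, Real.sq_sqrt hAB.le]
  exact hsq

lemma integrable_f {a t : ℝ} (ha : 0 < a) (hat : a < t) (hB : (1 - t) ^ 2 < a ^ 2)
    (hc : 0 < a ^ 2 + t - t ^ 2) (hv : t ^ 2 - a ^ 2 < 1) :
    MeasureTheory.IntegrableOn
      (fun x : ℝ => 1 / Real.sqrt ((x / (x ^ 2 + t - t ^ 2)) ^ 2 - 1)) (Set.Icc a t) := by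
  rw [integrableOn_Icc_iff_integrableOn_Ioo]
  have h1 : MeasureTheory.IntegrableOn
      (fun x : ℝ => x / Real.sqrt (t ^ 2 - x ^ 2) * (1 - 0 / (1 - (t ^ 2 - x ^ 2))))
      (Set.Ioc a t) := by
    apply intervalIntegral.integrableOn_deriv_of_nonneg (HFun_cont (k := 0) ha hv)
    · intro x hx
      exact HFun_deriv (by nlinarith [hx.1, hx.2]) (by nlinarith [hx.1, hx.2])
    · intro x hx
      have : 0 < x := ha.trans hx.1
      simp only [zero_div, sub_zero, mul_one]
      positivity
  have h2 := (h1.mono_set Set.Ioo_subset_Ioc_self).mul_const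
    (t / Real.sqrt (a ^ 2 * (a ^ 2 - (1 - t) ^ 2)))
  refine MeasureTheory.Integrable.mono' h2 ?_ ?_
  · apply Measurable.aestronglyMeasurable
    fun_prop
  · refine (MeasureTheory.ae_restrict_iff' measurableSet_Ioo).2 (Filter.Eventually.of_forall ?_)
    intro x hx
    have hx0 : 0 < x := ha.trans hx.1
    have hax : a ^ 2 < x ^ 2 := by nlinarith [hx.1]
    have hxt : x ^ 2 < t ^ 2 := by nlinarith [hx.2]
    rw [integrand_eq hx0 hx.2 (by linarith) (by linarith)]
    have hc' : 0 < x ^ 2 + t - t ^ 2 := by linarith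
    rw [Real.norm_of_nonneg (by positivity)]
    simp only [zero_div, sub_zero, mul_one]
    have hB' : 0 < a ^ 2 - (1 - t) ^ 2 := by linarith
    apply mul_le_mul_of_nonneg_left _ (by positivity)
    apply div_le_div₀ (by linarith) (by linarith) (Real.sqrt_pos.2 (by positivity))
    apply Real.sqrt_le_sqrt
    apply mul_le_mul hax.le (by linarith) hB'.le (by positivity)

lemma xa_lower {a t : ℝ} (ha : 0 < a) (ht : 1 < t) (hat : a < t) (hB : (1 - t) ^ 2 < a ^ 2)
    (hc : 0 < a ^ 2 + t - t ^ 2) (hv : t ^ 2 - a ^ 2 < 1) :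
    Real.sqrt (t ^ 2 - a ^ 2) - (t ^ 2 - 1) / 2 * LFun (Real.sqrt (t ^ 2 - a ^ 2)) ≤
      xaFun a t := by
  have := intervalIntegral.sub_le_integral_of_hasDeriv_right_of_le hat.le
    (HFun_cont (k := (t ^ 2 - 1) / 2) ha hv)
    (g' := fun x => x / Real.sqrt (t ^ 2 - x ^ 2) *
      (1 - ((t ^ 2 - 1) / 2) / (1 - (t ^ 2 - x ^ 2))))
    (fun x hx => (HFun_deriv (by nlinarith [hx.1, hx.2])
      (by nlinarith [hx.1, hx.2])).hasDerivWithinAt)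
    (integrable_f ha hat hB hc hv) (by
      intro x hx
      have hx0 : 0 < x := ha.trans hx.1
      have hax : a ^ 2 < x ^ 2 := by nlinarith [hx.1]
      rw [integrand_eq hx0 hx.2 (by linarith) (by linarith)]
      apply mul_le_mul_of_nonneg_left _ (by positivity)
      exact F_lower ht hx0 (by linarith) (by linarith) (by linarith))
  rw [HFun_end] at this
  unfold xaFun
  unfold HFun at this
  linarith

lemma xa_upper {a t : ℝ} (ha : 0 < a) (ht : t < 1) (hat : a < t) (hη : 1 - t ≤ a ^ 2 / 4)
    (hB : (1 - t) ^ 2 < a ^ 2)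
    (hc : 0 < a ^ 2 + t - t ^ 2) (hv : t ^ 2 - a ^ 2 < 1) :
    xaFun a t ≤ Real.sqrt (t ^ 2 - a ^ 2) +
      (1 - t) * ((1 + (1 - t) / (2 * a ^ 2)) / (1 - 2 * (1 - t) / a ^ 2)) *
        LFun (Real.sqrt (t ^ 2 - a ^ 2)) := by
  have := intervalIntegral.integral_le_sub_of_hasDeriv_right_of_le hat.le
    (HFun_cont
      (k := -((1 - t) * ((1 + (1 - t) / (2 * a ^ 2)) / (1 - 2 * (1 - t) / a ^ 2)))) ha hv)
    (g' := fun x => x / Real.sqrt (t ^ 2 - x ^ 2) *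
      (1 - (-((1 - t) * ((1 + (1 - t) / (2 * a ^ 2)) / (1 - 2 * (1 - t) / a ^ 2))))
        / (1 - (t ^ 2 - x ^ 2))))
    (fun x hx => (HFun_deriv (by nlinarith [hx.1, hx.2])
      (by nlinarith [hx.1, hx.2])).hasDerivWithinAt)
    (integrable_f ha hat hB hc hv) (by
      intro x hx
      have hx0 : 0 < x := ha.trans hx.1
      have hax : a ^ 2 < x ^ 2 := by nlinarith [hx.1]
      rw [integrand_eq hx0 hx.2 (by linarith) (by linarith)]
      apply mul_le_mul_of_nonneg_left _ (by positivity)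
      exact F_upper ha ht (by linarith) hx.1.le hx.2 hη (by linarith))
  rw [HFun_end] at this
  unfold xaFun
  unfold HFun at this
  linarith

/-- For `a₀ < a < 1` (where `a₀` is the zero of `g`) there is `η > 0` with
`η < min(a,1−a)` such that `x_a(t) < √(1−a²)` for `1−η ≤ t < 1` and
`x_a(t) > √(1−a²)` for `1 < t ≤ 1+η`. -/
theorem xa_comparison_above_a0 (a₀ a : ℝ) (h₀ : a₀ ∈ Set.Ioo (0:ℝ) 1)
    (hz : gFun a₀ = 0) (ha : a₀ < a) (ha1 : a < 1) :
    ∃ η > 0, η < min a (1 - a) ∧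
      (∀ t : ℝ, 1 - η ≤ t → t < 1 → xaFun a t < Real.sqrt (1 - a ^ 2)) ∧
      (∀ t : ℝ, 1 < t → t ≤ 1 + η → Real.sqrt (1 - a ^ 2) < xaFun a t) := by
  have ha0 : 0 < a := h₀.1.trans ha
  have hkey := key_pos h₀ hz ha ha1
  have hp : 0 < 1 - a ^ 2 := by nlinarith
  set S := Real.sqrt (1 - a ^ 2) with hS
  have hS0 : 0 < S := Real.sqrt_pos.2 hp
  have hSsq : S ^ 2 = 1 - a ^ 2 := Real.sq_sqrt hp.le
  have hS1 : S < 1 := by nlinarith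
  have hT1 : Real.sqrt ((1:ℝ) ^ 2 - a ^ 2) = S := by rw [hS, one_pow]
  have h2S : 2 / (S + S) = 1 / S := by
    rw [div_eq_div_iff (by positivity) hS0.ne']; ring
  have hSS : S + Real.sqrt ((1:ℝ) ^ 2 - a ^ 2) ≠ 0 := by rw [hT1]; positivity
  have c1 : ContinuousAt (fun t : ℝ => Real.sqrt (t ^ 2 - a ^ 2)) 1 := by fun_prop
  have c2 : ContinuousAt (fun t : ℝ => LFun (Real.sqrt (t ^ 2 - a ^ 2))) 1 := by
    have c3 : ContinuousAt LFun (Real.sqrt ((1:ℝ) ^ 2 - a ^ 2)) := by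
      rw [hT1]
      exact (LFun_deriv hS0.le hS1).continuousAt
    exact ContinuousAt.comp (f := fun t : ℝ => Real.sqrt (t ^ 2 - a ^ 2)) c3 c1
  have ev1 : ∀ᶠ t in nhds (1:ℝ),
      LFun (Real.sqrt (t ^ 2 - a ^ 2)) < 2 / (S + Real.sqrt (t ^ 2 - a ^ 2)) := by
    apply ContinuousAt.eventually_lt c2
    · apply continuousAt_const.div (continuousAt_const.add c1)
      exact hSS
    · rw [hT1, h2S]; exact hkey
  have ev2 : ∀ᶠ t in nhds (1:ℝ),
      ((1 + (1 - t) / (2 * a ^ 2)) / (1 - 2 * (1 - t) / a ^ 2)) *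
        LFun (Real.sqrt (t ^ 2 - a ^ 2)) < (1 + t) / (S + Real.sqrt (t ^ 2 - a ^ 2)) := by
    apply ContinuousAt.eventually_lt
    · refine ContinuousAt.mul (ContinuousAt.div (by fun_prop) (by fun_prop) (by norm_num)) c2
    · apply ContinuousAt.div (by fun_prop) (continuousAt_const.add c1)
      exact hSS
    · rw [hT1, one_add_one_eq_two, h2S]; simpa using hkey
  obtain ⟨δ, hδ, hd⟩ := Metric.eventually_nhds_iff.1 (ev1.and ev2)
  refine ⟨min (δ / 2) (min (a ^ 2 / 4) ((1 - a) / 2)), ?_, ?_, ?_, ?_⟩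
  · have : 0 < 1 - a := by linarith
    positivity
  · have h1 : min (δ / 2) (min (a ^ 2 / 4) ((1 - a) / 2)) ≤ a ^ 2 / 4 :=
      (min_le_right _ _).trans (min_le_left _ _)
    have h2 : min (δ / 2) (min (a ^ 2 / 4) ((1 - a) / 2)) ≤ (1 - a) / 2 :=
      (min_le_right _ _).trans (min_le_right _ _)
    apply lt_min
    · nlinarith
    · linarith
  · intro t h1 h2
    have g0 : 1 - t ≤ min (δ / 2) (min (a ^ 2 / 4) ((1 - a) / 2)) := by linarith
    obtain ⟨g1, g2⟩ := le_min_iff.1 g0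
    obtain ⟨g3, g4⟩ := le_min_iff.1 g2
    have hat : a < t := by linarith
    have hdt := (hd (y := t) (by rw [Real.dist_eq, abs_lt]; constructor <;> linarith)).2
    have hu := xa_upper ha0 h2 hat g3 (by nlinarith) (by nlinarith) (by nlinarith)
    have hq : 0 < t ^ 2 - a ^ 2 := by nlinarith
    have hTsq := Real.sq_sqrt hq.le
    have hT0 := Real.sqrt_pos.2 hq
    set T := Real.sqrt (t ^ 2 - a ^ 2)
    have hm := mul_lt_mul_of_pos_left hdt (sub_pos.2 h2)
    have e : (1 - t) * ((1 + t) / (S + T)) = S - T := by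
      have : S + T ≠ 0 := by positivity
      rw [mul_div_assoc', div_eq_iff this]
      linear_combination hTsq - hSsq
    rw [e] at hm
    linarith
  · intro t h1 h2
    have g0 : t - 1 ≤ min (δ / 2) (min (a ^ 2 / 4) ((1 - a) / 2)) := by linarith
    obtain ⟨g1, g2⟩ := le_min_iff.1 g0
    obtain ⟨g3, g4⟩ := le_min_iff.1 g2
    have hat : a < t := by linarith
    have hdt := (hd (y := t) (by rw [Real.dist_eq, abs_lt]; constructor <;> linarith)).1
    have hu := xa_lower ha0 h1 hat (by nlinarith) (by nlinarith) (by nlinarith)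
    have hq : 0 < t ^ 2 - a ^ 2 := by nlinarith
    have hTsq := Real.sq_sqrt hq.le
    have hT0 := Real.sqrt_pos.2 hq
    set T := Real.sqrt (t ^ 2 - a ^ 2)
    have hm := mul_lt_mul_of_pos_left hdt (by nlinarith : 0 < (t ^ 2 - 1) / 2)
    have e : (t ^ 2 - 1) / 2 * (2 / (S + T)) = T - S := by
      have : S + T ≠ 0 := by positivity
      rw [mul_div_assoc', div_eq_iff this]
      linear_combination hSsq - hTsq
    rw [e] at hm
    linarith
end

section
/- Let a₀ ∈ (0,1) be the unique zero of g(a) = −log((1 + √(1 − a²))/a) + 1/√(1 − a²). Then there exists η > 0 (with η < min(a₀, 1−a₀)) such that x_{a₀}(t) < √(1 − a₀²) for all t with 0 < |t − 1| ≤ η. -/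
namespace XaProof

noncomputable def S (c : ℝ) : ℝ := Real.sqrt (1 - c ^ 2)
noncomputable def L (c : ℝ) : ℝ := Real.log ((1 + Real.sqrt (1 - c ^ 2)) / c)

lemma S_pos {c : ℝ} (h0 : 0 < c) (h1 : c < 1) : 0 < S c :=
  Real.sqrt_pos.2 (by nlinarith)

lemma S_sq {c : ℝ} (h0 : 0 < c) (h1 : c < 1) : S c ^ 2 = 1 - c ^ 2 :=
  Real.sq_sqrt (by nlinarith)

lemma S_deriv {c : ℝ} (h0 : 0 < c) (h1 : c < 1) : HasDerivAt S (-c / S c) c := by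
  have h : HasDerivAt (fun c : ℝ => 1 - c ^ 2) (-(2 * c)) c := by
    simpa using (hasDerivAt_pow 2 c).const_sub 1
  have h2 := h.sqrt (by nlinarith)
  have hS := S_pos h0 h1
  convert! h2 using 1
  change _ = _ / (2 * S c)
  field_simp

lemma L_deriv {c : ℝ} (h0 : 0 < c) (h1 : c < 1) : HasDerivAt L (-1 / (c * S c)) c := by
  have hS := S_pos h0 h1
  have hS2 := S_sq h0 h1
  have h := (((S_deriv h0 h1).const_add 1).div (hasDerivAt_id c) h0.ne').log
    (by simp only [Pi.div_apply, id]; positivity)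
  convert! h using 1
  simp only [Pi.div_apply, id]
  field_simp
  nlinarith

lemma pointwise {κ b y δ : ℝ} (hκ : 0 < κ) (hb : 0 < b) (hby : b ≤ y) (hy : y < 1)
    (h1 : 3 * |δ| ≤ κ * b ^ 4) (h2 : 2 * |δ| ≤ b ^ 2) (h3 : |δ| ≤ 1 / 2) :
    (y ^ 2 - δ) / Real.sqrt (y ^ 2 - δ ^ 2) ≤ (1 + κ * δ ^ 2) * y - (δ - δ ^ 2 / 2) / y := by
  have hy0 : 0 < y := hb.trans_le hby
  have hb2 : b ^ 2 ≤ y ^ 2 := by gcongr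
  have hb4 : b ^ 4 ≤ y ^ 4 := by gcongr
  have hd0 := abs_nonneg δ
  have hdd : δ ^ 2 = |δ| ^ 2 := (sq_abs δ).symm
  have hle := le_abs_self δ
  have hle' := neg_abs_le δ
  have hyd : 0 < y ^ 2 - δ := by nlinarith
  have hdy : 2 * δ ^ 2 ≤ y ^ 2 := by rw [hdd]; nlinarith
  have hpos : 0 < y ^ 2 - δ ^ 2 := by nlinarith
  set z := δ ^ 2 / y ^ 2 with hz
  have hz0 : 0 ≤ z := by positivity
  have hz1 : z ≤ 1 / 2 := by rw [hz, div_le_iff₀ (by positivity)]; linarith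
  have hzy : z * y ^ 2 = δ ^ 2 := by rw [hz]; field_simp
  have hkey : 1 ≤ (1 + z / 2 + z ^ 2) ^ 2 * (1 - z) := by
    have : (1 + z / 2 + z ^ 2) ^ 2 * (1 - z) - 1 = z ^ 2 * (5 / 4 * (1 - z) - z ^ 3) := by ring
    have h3 : z ^ 3 ≤ (1 / 2) ^ 3 := by gcongr
    have : 0 ≤ z ^ 2 * (5 / 4 * (1 - z) - z ^ 3) := by
      apply mul_nonneg (by positivity); linarith
    linarith
  have hsq : y ≤ (1 + z / 2 + z ^ 2) * Real.sqrt (y ^ 2 - δ ^ 2) := by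
    refine (pow_le_pow_iff_left₀ hy0.le (by positivity) two_ne_zero).1 ?_
    rw [mul_pow, Real.sq_sqrt hpos.le, ← hzy]
    nlinarith [mul_le_mul_of_nonneg_left hkey (sq_nonneg y)]
  have hr : 0 < Real.sqrt (y ^ 2 - δ ^ 2) := Real.sqrt_pos.2 hpos
  have hA : (y ^ 2 - δ) / Real.sqrt (y ^ 2 - δ ^ 2) ≤ (y ^ 2 - δ) * (1 + z / 2 + z ^ 2) / y := by
    rw [div_le_div_iff₀ hr hy0]
    nlinarith [mul_le_mul_of_nonneg_left hsq hyd.le]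
  refine hA.trans ?_
  rw [div_le_iff₀ hy0]
  have e : ((1 + κ * δ ^ 2) * y - (δ - δ ^ 2 / 2) / y) * y
      = (1 + κ * δ ^ 2) * y ^ 2 - (δ - δ ^ 2 / 2) := by field_simp
  rw [e]
  have hq : -δ / 2 + (y ^ 2 - δ) * z ≤ κ * y ^ 4 := by
    have : (y ^ 2 - δ) * z ≤ 2 * δ ^ 2 := by rw [← hzy]; nlinarith
    have : κ * b ^ 4 ≤ κ * y ^ 4 := by gcongr
    nlinarith
  have := mul_le_mul_of_nonneg_left hq hz0
  have e2 : κ * δ ^ 2 * y ^ 2 = z * (κ * y ^ 4) := by rw [← hzy]; ring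
  have e3 : (y ^ 2 - δ) * (1 + z / 2 + z ^ 2)
     = y ^ 2 - δ + (z * y ^ 2) / 2 + z * (-δ / 2 + (y ^ 2 - δ) * z) := by ring
  rw [e3, hzy]
  nlinarith

lemma second_order {a : ℝ} (h0 : 0 < a) (h1 : a < 1) (hz : L a = 1 / S a) :
    ∀ᶠ δ in nhds (0:ℝ), S (a * (1 - δ)) - (δ - δ ^ 2 / 2) * L (a * (1 - δ)) - (1 - δ) * S a
      + (1 / (4 * S a ^ 3)) * δ ^ 2 ≤ 0 := by
  set k := 1 / (4 * S a ^ 3) with hk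
  have hS := S_pos h0 h1
  have hS2 := S_sq h0 h1
  set H : ℝ → ℝ := fun δ => S (a * (1 - δ)) - (δ - δ ^ 2 / 2) * L (a * (1 - δ)) - (1 - δ) * S a
      + k * δ ^ 2 with hH
  have hp : ∀ δ : ℝ, HasDerivAt (fun δ : ℝ => a * (1 - δ)) (-a) δ := fun δ => by
    simpa using ((hasDerivAt_id δ).const_sub 1).const_mul a
  have hev : ∀ᶠ δ in nhds (0:ℝ), 0 < 1 - δ ∧ a * (1 - δ) < 1 := by
    have c1 : ContinuousAt (fun δ : ℝ => 1 - δ) 0 := by fun_prop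
    have c2 : ContinuousAt (fun δ : ℝ => a * (1 - δ)) 0 := by fun_prop
    exact (c1.eventually (lt_mem_nhds (by simp))).and (c2.eventually (gt_mem_nhds (by simpa)))
  have hSd : ∀ δ : ℝ, 0 < 1 - δ → a * (1 - δ) < 1 →
      HasDerivAt (fun δ => S (a * (1 - δ))) (a ^ 2 * (1 - δ) / S (a * (1 - δ))) δ := by
    intro δ h2 h3
    have h4 : 0 < a * (1 - δ) := by positivity
    have := (S_deriv h4 h3).comp δ (hp δ)
    convert! this using 1
    ring
  have hLd : ∀ δ : ℝ, 0 < 1 - δ → a * (1 - δ) < 1 →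
      HasDerivAt (fun δ => L (a * (1 - δ))) (1 / ((1 - δ) * S (a * (1 - δ)))) δ := by
    intro δ h2 h3
    have h4 : 0 < a * (1 - δ) := by positivity
    have hS' := S_pos h4 h3
    have := (L_deriv h4 h3).comp δ (hp δ)
    convert! this using 1
    field_simp
  have hq : ∀ δ : ℝ, HasDerivAt (fun δ : ℝ => δ - δ ^ 2 / 2) (1 - δ) δ := fun δ => by
    convert! (hasDerivAt_id δ).sub ((hasDerivAt_pow 2 δ).div_const 2) using 1
    simp
  have hl : ∀ δ : ℝ, HasDerivAt (fun δ : ℝ => 1 - δ) (-1) δ := fun δ => by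
    simpa using (hasDerivAt_id δ).const_sub 1
  have hd1 : ∀ δ : ℝ, 0 < 1 - δ → a * (1 - δ) < 1 → HasDerivAt H
      (a ^ 2 * (1 - δ) / S (a * (1 - δ)) - ((1 - δ) * L (a * (1 - δ)) +
        (δ - δ ^ 2 / 2) * (1 / ((1 - δ) * S (a * (1 - δ))))) - (-1) * S a + k * (2 * δ)) δ := by
    intro δ h2 h3
    have := (((hSd δ h2 h3).sub ((hq δ).mul (hLd δ h2 h3))).sub ((hl δ).mul_const (S a))).add
      ((hasDerivAt_pow 2 δ).const_mul k)
    convert! this using 1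
    simp
  have hz1 : (0:ℝ) < 1 - 0 := by norm_num
  have hz2 : a * (1 - 0) < 1 := by simpa
  have ed : deriv H =ᶠ[nhds 0] fun δ => (a ^ 2 * (1 - δ) / S (a * (1 - δ)) - ((1 - δ) * L (a * (1 - δ)) +
        (δ - δ ^ 2 / 2) * (1 / ((1 - δ) * S (a * (1 - δ))))) - (-1) * S a + k * (2 * δ)) := by
    filter_upwards [hev] with δ h
    exact (hd1 δ h.1 h.2).deriv
  have hd0 : deriv H 0 = 0 := by
    rw [(hd1 0 hz1 hz2).deriv]
    simp only [sub_zero, mul_one, hz]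
    field_simp
    nlinarith
  have hd2 : deriv (deriv H) 0 = -1 / (2 * S a ^ 3) := by
    rw [ed.deriv_eq]
    have hne : S (a * (1 - 0)) ≠ 0 := by simpa using hS.ne'
    have A := (((hl 0).const_mul (a ^ 2)).div (hSd 0 hz1 hz2) hne)
    have B := (hl 0).mul (hLd 0 hz1 hz2)
    have C := (hq 0).mul (((hl 0).mul (hSd 0 hz1 hz2)).fun_inv (by simpa using hS.ne'))
    have D := ((hasDerivAt_id (0:ℝ)).const_mul 2).const_mul k
    have E := ((A.sub (B.add C)).sub_const ((-1) * S a)).add D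
    have E2 := E.deriv
    simp only [one_div]
    refine Eq.trans E2 ?_
    simp only [sub_zero, mul_one, hz, hk]
    simp only [Pi.mul_apply, sub_zero, mul_one]
    have : a ^ 2 = 1 - S a ^ 2 := by linarith
    field_simp
    simp only [this]
    ring
  have hm : IsLocalMax H 0 := isLocalMax_of_deriv_deriv_neg
    (by rw [hd2]; have : 0 < 2 * S a ^ 3 := by positivity
        exact div_neg_of_neg_of_pos (by norm_num) this) hd0 (hd1 0 hz1 hz2).continuousAt
  have hH0 : H 0 = 0 := by simp [hH]
  filter_upwards [hm] with δ h
  rw [hH0] at h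
  exact h

lemma xa_bound {a t δ κ : ℝ} (h0 : 0 < a) (hat : a < t) (ht : t ≤ 2) (hκ : 0 < κ)
    (hδ : δ * t = t - 1)
    (hd1 : 3 * |δ| ≤ κ * (a / 2) ^ 4) (hd2 : 2 * |δ| ≤ (a / 2) ^ 2) (hd3 : |δ| ≤ 1 / 2)
    (hi : IntervalIntegrable (fun x => 1 / Real.sqrt ((x / (x ^ 2 + t - t ^ 2)) ^ 2 - 1))
      MeasureTheory.volume a t) :
    xaFun a t ≤ t * ((1 + κ * δ ^ 2) * S (a / t) - (δ - δ ^ 2 / 2) * L (a / t)) := by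
  have ht0 : 0 < t := h0.trans hat
  set Φ : ℝ → ℝ := fun x => t * ((δ - δ ^ 2 / 2) * L (x / t) - (1 + κ * δ ^ 2) * S (x / t)) with hΦ
  have hmain : xaFun a t ≤ Φ t - Φ a := by
    apply intervalIntegral.integral_le_sub_of_hasDeriv_right_of_le
      (g' := fun x => ((1 + κ * δ ^ 2) * (x / t) - (δ - δ ^ 2 / 2) / (x / t)) / S (x / t)) hat.le
    · have hS : Continuous S := by unfold S; fun_prop
      have hL : ContinuousOn (fun x => L (x / t)) (Set.Icc a t) := by
        unfold L
        apply ContinuousOn.log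
        · apply ContinuousOn.div (by fun_prop) (by fun_prop)
          intro x hx
          have : 0 < x := h0.trans_le hx.1
          positivity
        · intro x hx
          have : 0 < x := h0.trans_le hx.1
          positivity
      have hS' : ContinuousOn (fun x => S (x / t)) (Set.Icc a t) := by fun_prop
      fun_prop
    · intro x hx
      have hx0 : 0 < x := h0.trans hx.1
      have hy0 : 0 < x / t := by positivity
      have hy1 : x / t < 1 := (div_lt_one ht0).2 hx.2
      have hS := S_pos hy0 hy1
      have hd : HasDerivAt (fun x : ℝ => x / t) (1 / t) x := (hasDerivAt_id x).div_const t
      have l := ((L_deriv hy0 hy1).comp x hd).const_mul (δ - δ ^ 2 / 2)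
      have s := ((S_deriv hy0 hy1).comp x hd).const_mul (1 + κ * δ ^ 2)
      have := ((l.sub s).const_mul t).hasDerivWithinAt (s := Set.Ioi x)
      convert! this using 1
      field_simp
      ring
    · exact (intervalIntegrable_iff_integrableOn_Icc_of_le hat.le).1 hi
    · intro x hx
      have hx0 : 0 < x := h0.trans hx.1
      set y := x / t with hy
      have hxy : x = t * y := by rw [hy]; field_simp
      have hy0 : 0 < y := by positivity
      have hy1 : y < 1 := (div_lt_one ht0).2 hx.2
      have hS := S_pos hy0 hy1
      have hay : a / 2 ≤ y := by
        rw [hy]; exact div_le_div₀ hx0.le hx.1.le ht0 ht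
      have hp := pointwise hκ (by positivity) hay hy1 hd1 hd2 hd3
      have hb2 : (a / 2) ^ 2 ≤ y ^ 2 := by gcongr
      have hle := le_abs_self δ
      have hn := abs_nonneg δ
      have hyd : 0 < y ^ 2 - δ := by nlinarith
      have hdd : δ ^ 2 = |δ| ^ 2 := (sq_abs δ).symm
      have hpos : 0 < y ^ 2 - δ ^ 2 := by
        rw [hdd]; nlinarith [pow_pos h0 2]
      have hr : 0 < Real.sqrt (y ^ 2 - δ ^ 2) := Real.sqrt_pos.2 hpos
      have hS2 := S_sq hy0 hy1
      have e1 : x ^ 2 + t - t ^ 2 = t ^ 2 * (y ^ 2 - δ) := by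
        rw [hxy]; linear_combination t * hδ
      have e2 : (x / (x ^ 2 + t - t ^ 2)) ^ 2 - 1
          = (S y * Real.sqrt (y ^ 2 - δ ^ 2) / (y ^ 2 - δ)) ^ 2 := by
        rw [e1, div_pow _ (y ^ 2 - δ), mul_pow, Real.sq_sqrt hpos.le, hS2, hxy]
        have : t * (1 - δ) = 1 := by linarith
        have e : t * y / (t ^ 2 * (y ^ 2 - δ)) = (1 - δ) * y / (y ^ 2 - δ) := by
          field_simp
          linear_combination -this
        rw [e]
        field_simp
        ring
      have e3 : 1 / Real.sqrt ((x / (x ^ 2 + t - t ^ 2)) ^ 2 - 1)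
          = ((y ^ 2 - δ) / Real.sqrt (y ^ 2 - δ ^ 2)) / S y := by
        rw [e2, Real.sqrt_sq (by positivity)]
        field_simp
      change 1 / Real.sqrt ((x / (x ^ 2 + t - t ^ 2)) ^ 2 - 1) ≤ _
      rw [e3]
      exact div_le_div_of_nonneg_right hp hS.le
  refine hmain.trans (le_of_eq ?_)
  have hLt : L (t / t) = 0 := by simp [L, ht0.ne']
  have hSt : S (t / t) = 0 := by simp [S, ht0.ne']
  simp only [hΦ, hLt, hSt]
  ring

end XaProof

open XaProof in
theorem xa_comparison_at_a0 (a₀ : ℝ) (h₀ : a₀ ∈ Set.Ioo (0:ℝ) 1)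
    (hz : gFun a₀ = 0) :
    ∃ η > 0, η < min a₀ (1 - a₀) ∧
      ∀ t : ℝ, 0 < |t - 1| → |t - 1| ≤ η → xaFun a₀ t < Real.sqrt (1 - a₀ ^ 2) := by
  obtain ⟨h0, h1⟩ := h₀
  have hz' : L a₀ = 1 / S a₀ := by
    have : -L a₀ + 1 / S a₀ = 0 := hz
    linarith
  have hS := S_pos h0 h1
  obtain ⟨r, hr, hsec⟩ := Metric.eventually_nhds_iff.1 (second_order h0 h1 hz')
  set k := 1 / (4 * S a₀ ^ 3) with hk
  have hk0 : 0 < k := by positivity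
  set κ := k / 2 with hκ
  have hκ0 : 0 < κ := by positivity
  set m := min (min (r / 2) (1 / 2)) (min (κ * (a₀ / 2) ^ 4 / 3) ((a₀ / 2) ^ 2 / 2)) with hm
  have hm0 : 0 < m := by simp only [hm, lt_min_iff]; refine ⟨⟨?_, ?_⟩, ?_, ?_⟩ <;> positivity
  have m1 : m ≤ r / 2 := (min_le_left _ _).trans (min_le_left _ _)
  have m2 : m ≤ 1 / 2 := (min_le_left _ _).trans (min_le_right _ _)
  have m3 : m ≤ κ * (a₀ / 2) ^ 4 / 3 := (min_le_right _ _).trans (min_le_left _ _)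
  have m4 : m ≤ (a₀ / 2) ^ 2 / 2 := (min_le_right _ _).trans (min_le_right _ _)
  have hM : 0 < min a₀ (1 - a₀) := lt_min h0 (by linarith)
  refine ⟨min (m / 2) (min a₀ (1 - a₀) / 2), by positivity, ?_, ?_⟩
  · exact (min_le_right _ _).trans_lt (by linarith)
  intro t ht1 ht2
  have u1 : |t - 1| ≤ m / 2 := ht2.trans (min_le_left _ _)
  have u2 : |t - 1| ≤ min a₀ (1 - a₀) / 2 := ht2.trans (min_le_right _ _)
  have u3 : min a₀ (1 - a₀) ≤ 1 - a₀ := min_le_right _ _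
  have v1 := le_abs_self (t - 1)
  have v2 := neg_abs_le (t - 1)
  have ht0 : 1 / 2 ≤ t := by linarith
  have htp : 0 < t := by linarith
  have hat : a₀ < t := by linarith
  by_cases hi : IntervalIntegrable (fun x => 1 / Real.sqrt ((x / (x ^ 2 + t - t ^ 2)) ^ 2 - 1))
      MeasureTheory.volume a₀ t
  swap
  · unfold xaFun
    rw [intervalIntegral.integral_undef hi]
    exact hS
  set δ := (t - 1) / t with hδ
  have hδt : δ * t = t - 1 := by rw [hδ]; field_simp
  have hδm : |δ| ≤ m := by
    rw [hδ, abs_div, abs_of_pos htp, div_le_iff₀ htp]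
    nlinarith
  have hδ0 : δ ≠ 0 := by
    intro h
    rw [h, zero_mul] at hδt
    rw [← hδt] at ht1
    simp at ht1
  have hb := xa_bound h0 hat (by linarith) hκ0 hδt (by linarith) (by linarith) (by linarith) hi
  refine hb.trans_lt ?_
  have hs := hsec (y := δ) (by rw [Real.dist_eq, sub_zero]; linarith)
  have hp : a₀ * (1 - δ) = a₀ / t := by rw [hδ]; field_simp; ring
  rw [hp] at hs
  have hS1 : S (a₀ / t) ≤ 1 := by
    unfold S
    refine Real.sqrt_le_iff.2 ⟨zero_le_one, ?_⟩
    nlinarith [sq_nonneg (a₀ / t)]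
  have hd2 : 0 < δ ^ 2 := by positivity
  have hlt : (1 + κ * δ ^ 2) * S (a₀ / t) - (δ - δ ^ 2 / 2) * L (a₀ / t) < (1 - δ) * S a₀ := by
    have : κ * δ ^ 2 * S (a₀ / t) ≤ κ * δ ^ 2 := mul_le_of_le_one_right (by positivity) hS1
    have : κ * δ ^ 2 < k * δ ^ 2 := by gcongr; linarith
    linarith
  calc _ < t * ((1 - δ) * S a₀) := by gcongr
    _ = Real.sqrt (1 - a₀ ^ 2) := by
      change _ = S a₀
      linear_combination (-S a₀) * hδt
end

section
/- Let r₁ : [−1, 1] → ℝ² and r₂ : [−1, 1] → ℝ² be continuously differentiable injective curves with r₁(0) = r₂(0) = p, whose derivatives r₁′(0) and r₂′(0) are linearly independent, and whose images intersect only at the point p. Then for every D > 0 there exists d > 0 such that: for all continuous curves l₁, l₂ : [−1, 1] → ℝ² satisfying ‖lᵢ(s) − rᵢ(s)‖ < d for all s ∈ [−1, 1] and i ∈ {1, 2}, there exist s₁, s₂ ∈ [−1, 1] with l₁(s₁) = l₂(s₂) and ‖l₁(s₁) − p‖ < D. -/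
theorem tis_arc (h : ℝ → ℝ) (hc : Continuous h) (c ε : ℝ)
    (hs : ∀ t ∈ Set.Icc (-ε) ε, 0 < Real.sin (h t - c))
    (x y : ℝ) (hx : x ∈ Set.Icc (-ε) ε) (hy : y ∈ Set.Icc (-ε) ε)
    (h1 : c < h x) (h2 : h x < c + Real.pi) : c < h y ∧ h y < c + Real.pi := by
  constructor
  · by_contra! hn
    obtain ⟨z, hz, hz'⟩ := isPreconnected_Icc.intermediate_value hy hx hc.continuousOn
      (show c ∈ Set.Icc (h y) (h x) from ⟨hn, h1.le⟩)
    have := hs z hz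
    simp [hz'] at this
  · by_contra! hn
    obtain ⟨z, hz, hz'⟩ := isPreconnected_Icc.intermediate_value hx hy hc.continuousOn
      (show c + Real.pi ∈ Set.Icc (h x) (h y) from ⟨h2.le, hn⟩)
    have := hs z hz
    simp [hz'] at this

/-- Poincaré–Miranda in the plane. -/
theorem tis_miranda (F : ℝ × ℝ → ℂ) (hF : Continuous F) (ε : ℝ) (hε : 0 < ε)
    (hR : ∀ t ∈ Set.Icc (-ε) ε, 0 < (F (ε, t)).re)
    (hL : ∀ t ∈ Set.Icc (-ε) ε, (F (-ε, t)).re < 0)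
    (hT : ∀ t ∈ Set.Icc (-ε) ε, 0 < (F (t, ε)).im)
    (hB : ∀ t ∈ Set.Icc (-ε) ε, (F (t, -ε)).im < 0) : ∃ z, F z = 0 := by
  by_contra! hne
  obtain ⟨G, ⟨hG0, hG⟩, -⟩ := Complex.isCoveringMap_exp.existsUnique_continuousMap_lifts
    (⟨fun z => ⟨F z, hne z⟩, by fun_prop⟩ : C(ℝ × ℝ, {z : ℂ // z ≠ 0})) (ε, ε)
    (Complex.log (F (ε, ε))) (by simp [Complex.exp_log (hne _)])
  have hGe : ∀ z, Complex.exp (G z) = F z := fun z =>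
    congrArg Subtype.val (congrFun hG z)
  have hre : ∀ z, (F z).re = Real.exp (G z).re * Real.cos (G z).im := fun z => by
    rw [← hGe, Complex.exp_re]
  have him : ∀ z, (F z).im = Real.exp (G z).re * Real.sin (G z).im := fun z => by
    rw [← hGe, Complex.exp_im]
  have pe := fun z => Real.exp_pos (G z).re
  have cR : ∀ t ∈ Set.Icc (-ε) ε, 0 < Real.cos (G (ε, t)).im := fun t ht => by
    have := hR t ht
    rw [hre] at this
    exact pos_of_mul_pos_right this (pe _).le
  have cL : ∀ t ∈ Set.Icc (-ε) ε, Real.cos (G (-ε, t)).im < 0 := fun t ht => by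
    have := hL t ht
    rw [hre] at this
    exact neg_of_mul_neg_right this (pe _).le
  have cT : ∀ t ∈ Set.Icc (-ε) ε, 0 < Real.sin (G (t, ε)).im := fun t ht => by
    have := hT t ht
    rw [him] at this
    exact pos_of_mul_pos_right this (pe _).le
  have cB : ∀ t ∈ Set.Icc (-ε) ε, Real.sin (G (t, -ε)).im < 0 := fun t ht => by
    have := hB t ht
    rw [him] at this
    exact neg_of_mul_neg_right this (pe _).le
  have e1 : ε ∈ Set.Icc (-ε) ε := ⟨by linarith, le_rfl⟩
  have e2 : -ε ∈ Set.Icc (-ε) ε := ⟨le_rfl, by linarith⟩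
  have hpi := Real.pi_pos
  have hG0' : (G (ε, ε)).im = (F (ε, ε)).arg := by rw [hG0, Complex.log_im]
  have b0 : 0 < (G (ε, ε)).im := by
    by_contra! hn
    have := Real.sin_nonpos_of_nonpos_of_neg_pi_le hn
      (by rw [hG0']; exact (Complex.neg_pi_lt_arg _).le)
    linarith [cT ε e1]
  have b1 : (G (ε, ε)).im < Real.pi / 2 := by
    by_contra! hn
    have := Real.cos_nonpos_of_pi_div_two_le_of_le hn
      (by rw [hG0']; linarith [Complex.arg_le_pi (F (ε, ε))])
    linarith [cR ε e1]
  have r := tis_arc (fun t => (G (ε, t)).im) (by fun_prop) (-(Real.pi / 2)) ε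
    (fun t ht => by simpa [Real.sin_add_pi_div_two] using cR t ht) ε (-ε) e1 e2
    (by linarith) (by linarith)
  have t := tis_arc (fun t => (G (t, ε)).im) (by fun_prop) 0 ε
    (fun t ht => by simpa using cT t ht) ε (-ε) e1 e2 (by linarith) (by linarith)
  have t' : Real.pi / 2 < (G (-ε, ε)).im := by
    by_contra! hn
    have := Real.cos_nonneg_of_mem_Icc ⟨by linarith, hn⟩
    linarith [cL ε e1]
  have l := tis_arc (fun t => (G (-ε, t)).im) (by fun_prop) (Real.pi / 2) ε
    (fun t ht => by simpa [Real.sin_sub_pi_div_two] using cL t ht) ε (-ε) e1 e2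
    (by linarith) (by linarith)
  have l' : Real.pi < (G (-ε, -ε)).im := by
    by_contra! hn
    have := Real.sin_nonneg_of_nonneg_of_le_pi (by linarith) hn
    linarith [cB (-ε) e2]
  have b := tis_arc (fun t => (G (t, -ε)).im) (by fun_prop) Real.pi ε
    (fun t ht => by simpa [Real.sin_sub_pi] using cB t ht) (-ε) ε e2 e1
    (by linarith) (by linarith)
  linarith

/-- Linear error estimate for a functional along a differentiable curve. -/
theorem tis_lin (r : ℝ → EuclideanSpace ℝ (Fin 2)) (p v : EuclideanSpace ℝ (Fin 2))
    (hp : r 0 = p) (hd : HasDerivAt r v 0) (φ : EuclideanSpace ℝ (Fin 2) →L[ℝ] ℝ) :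
    ∀ᶠ s in nhds (0:ℝ), |φ (r s - p) - s * φ v| ≤ (1/4) * |s| := by
  have h := (φ.hasFDerivAt.comp_hasDerivAt (0:ℝ) hd)
  rw [hasDerivAt_iff_isLittleO] at h
  have := h.def (show (0:ℝ) < 1/4 by norm_num)
  filter_upwards [this] with s hs
  simpa [hp] using hs

/-- Stability of transversal intersection: two `C¹` curves crossing
transversally at `p` (and nowhere else) have the property that all sufficiently
`C⁰`-close continuous curves still intersect, at a point close to `p`. -/
theorem transversal_intersection_stable
    (p : EuclideanSpace ℝ (Fin 2)) (r₁ r₂ : ℝ → EuclideanSpace ℝ (Fin 2))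
    (v₁ v₂ : EuclideanSpace ℝ (Fin 2))
    (hr₁ : ContDiffOn ℝ 1 r₁ (Set.Icc (-1) 1))
    (hr₂ : ContDiffOn ℝ 1 r₂ (Set.Icc (-1) 1))
    (hi₁ : Set.InjOn r₁ (Set.Icc (-1) 1))
    (hi₂ : Set.InjOn r₂ (Set.Icc (-1) 1))
    (hp₁ : r₁ 0 = p) (hp₂ : r₂ 0 = p)
    (hd₁ : HasDerivWithinAt r₁ v₁ (Set.Icc (-1) 1) 0)
    (hd₂ : HasDerivWithinAt r₂ v₂ (Set.Icc (-1) 1) 0)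
    (hli : LinearIndependent ℝ ![v₁, v₂])
    (honly : ∀ s₁ ∈ Set.Icc (-1:ℝ) 1, ∀ s₂ ∈ Set.Icc (-1:ℝ) 1,
      r₁ s₁ = r₂ s₂ → r₁ s₁ = p) :
    ∀ D > 0, ∃ d > 0, ∀ l₁ l₂ : ℝ → EuclideanSpace ℝ (Fin 2),
      ContinuousOn l₁ (Set.Icc (-1) 1) → ContinuousOn l₂ (Set.Icc (-1) 1) →
      (∀ s ∈ Set.Icc (-1:ℝ) 1, ‖l₁ s - r₁ s‖ < d) →
      (∀ s ∈ Set.Icc (-1:ℝ) 1, ‖l₂ s - r₂ s‖ < d) →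
      ∃ s₁ ∈ Set.Icc (-1:ℝ) 1, ∃ s₂ ∈ Set.Icc (-1:ℝ) 1,
        l₁ s₁ = l₂ s₂ ∧ ‖l₁ s₁ - p‖ < D := by
  intro D hD
  have hn : Set.Icc (-1:ℝ) 1 ∈ nhds (0:ℝ) := Icc_mem_nhds (by norm_num) (by norm_num)
  have hd₁' := hd₁.hasDerivAt hn
  have hd₂' := hd₂.hasDerivAt hn
  let b := basisOfLinearIndependentOfCardEqFinrank hli (by simp)
  have hb : ⇑b = ![v₁, v₂] := coe_basisOfLinearIndependentOfCardEqFinrank _ _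
  have hb0 : b 0 = v₁ := by rw [hb]; rfl
  have hb1 : b 1 = v₂ := by rw [hb]; rfl
  obtain ⟨φ, hφ⟩ : ∃ φ : EuclideanSpace ℝ (Fin 2) →L[ℝ] ℝ, ∀ x, φ x = b.coord 0 x :=
    ⟨LinearMap.toContinuousLinearMap (b.coord 0), fun x => rfl⟩
  obtain ⟨ψ, hψ⟩ : ∃ φ : EuclideanSpace ℝ (Fin 2) →L[ℝ] ℝ, ∀ x, φ x = b.coord 1 x :=
    ⟨LinearMap.toContinuousLinearMap (b.coord 1), fun x => rfl⟩
  have φ1 : φ v₁ = 1 := by rw [hφ, ← hb0]; simp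
  have φ2 : φ v₂ = 0 := by rw [hφ, ← hb1]; simp
  have ψ1 : ψ v₁ = 0 := by rw [hψ, ← hb0]; simp
  have ψ2 : ψ v₂ = 1 := by rw [hψ, ← hb1]; simp
  have hinj : ∀ x, φ x = 0 → ψ x = 0 → x = 0 := by
    intro x h0 h1
    apply b.ext_elem
    intro i
    rw [hφ] at h0
    rw [hψ] at h1
    fin_cases i
    · simpa using h0
    · simpa using h1
  have hcont : ∀ᶠ s in nhds (0:ℝ), ‖r₁ s - p‖ < D / 2 := by
    have := hd₁'.continuousAt.eventually (Metric.ball_mem_nhds (r₁ 0) (half_pos hD))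
    filter_upwards [this] with s hs
    rwa [hp₁, dist_eq_norm] at hs
  have hall := (((tis_lin r₁ p v₁ hp₁ hd₁' φ).and (tis_lin r₁ p v₁ hp₁ hd₁' ψ)).and
    ((tis_lin r₂ p v₂ hp₂ hd₂' φ).and (tis_lin r₂ p v₂ hp₂ hd₂' ψ))).and
      (hcont.and (Filter.eventually_mem_set.2 hn))
  obtain ⟨δ, hδ, hall⟩ := Metric.eventually_nhds_iff.1 hall
  obtain ⟨ε, hε, hεδ⟩ := exists_between hδ
  have key : ∀ s ∈ Set.Icc (-ε) ε, |φ (r₁ s - p) - s| ≤ ε / 4 ∧ |ψ (r₁ s - p)| ≤ ε / 4 ∧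
      |φ (r₂ s - p)| ≤ ε / 4 ∧ |ψ (r₂ s - p) - s| ≤ ε / 4 ∧ ‖r₁ s - p‖ < D / 2 ∧
      s ∈ Set.Icc (-1:ℝ) 1 := by
    intro s hs
    have hs' : |s| ≤ ε := abs_le.2 hs
    have := @hall s (by rw [Real.dist_eq, sub_zero]; linarith)
    rw [φ1, φ2, ψ1, ψ2, mul_one, mul_zero, sub_zero, sub_zero] at this
    obtain ⟨⟨⟨a1, a2⟩, a3, a4⟩, a5, a6⟩ := this
    exact ⟨by linarith, by linarith, by linarith, by linarith, a5, a6⟩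
  set M := ‖φ‖ + ‖ψ‖ + 1 with hM
  have hMpos : 0 < M := by positivity
  have hb : ∀ d x, ‖x‖ < d → |φ x| ≤ M * d ∧ |ψ x| ≤ M * d := by
    intro d x hx
    have hx0 := norm_nonneg x
    have h0 := φ.le_opNorm x
    have h1 := ψ.le_opNorm x
    rw [Real.norm_eq_abs] at h0 h1
    have := norm_nonneg φ
    have := norm_nonneg ψ
    constructor <;> nlinarith
  refine ⟨min (ε / (8 * M)) (D / 2), by positivity, ?_⟩
  set d := min (ε / (8 * M)) (D / 2) with hd
  have hMd : M * d ≤ ε / 8 := by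
    calc M * d ≤ M * (ε / (8 * M)) := by gcongr; exact min_le_left _ _
      _ = ε / 8 := by field_simp
  have hdD : d ≤ D / 2 := min_le_right _ _
  intro l₁ l₂ hl₁ hl₂ hc₁ hc₂
  have hee : -ε ≤ ε := by linarith
  have hsub : Set.Icc (-ε) ε ⊆ Set.Icc (-1:ℝ) 1 := fun s hs => (key s hs).2.2.2.2.2
  let c : ℝ → ℝ := fun s => (Set.projIcc (-ε) ε hee s : ℝ)
  have hcc : Continuous c := continuous_subtype_val.comp continuous_projIcc
  have hcm : ∀ s, c s ∈ Set.Icc (-ε) ε := fun s => (Set.projIcc (-ε) ε hee s).2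
  have hcid : ∀ s ∈ Set.Icc (-ε) ε, c s = s := fun s hs => by
    simp only [c, Set.projIcc_of_mem hee hs]
  have k1 : Continuous fun s => l₁ (c s) := hl₁.comp_continuous hcc fun s => hsub (hcm s)
  have k2 : Continuous fun s => l₂ (c s) := hl₂.comp_continuous hcc fun s => hsub (hcm s)
  have e1 : ε ∈ Set.Icc (-ε) ε := ⟨by linarith, le_rfl⟩
  have e2 : -ε ∈ Set.Icc (-ε) ε := ⟨le_rfl, by linarith⟩
  have est : ∀ s ∈ Set.Icc (-ε) ε, ∀ t ∈ Set.Icc (-ε) ε,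
      |φ (l₁ s - l₂ t) - s| ≤ 3 * ε / 4 ∧ |ψ (l₂ t - l₁ s) - t| ≤ 3 * ε / 4 := by
    intro s hs t ht
    obtain ⟨a1, a2, -, -, -, a3⟩ := key s hs
    obtain ⟨-, -, b1, b2, -, b3⟩ := key t ht
    obtain ⟨c1, c2⟩ := hb d _ (hc₁ s a3)
    obtain ⟨c3, c4⟩ := hb d _ (hc₂ t b3)
    simp only [map_sub, abs_le] at *
    constructor <;> constructor <;> linarith
  let F : ℝ × ℝ → ℂ := fun z =>
    (φ (l₁ (c z.1) - l₂ (c z.2)) : ℂ) + (ψ (l₂ (c z.2) - l₁ (c z.1)) : ℂ) * Complex.I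
  have k1' : Continuous fun z : ℝ × ℝ => l₁ (c z.1) := k1.comp continuous_fst
  have k2' : Continuous fun z : ℝ × ℝ => l₂ (c z.2) := k2.comp continuous_snd
  have hFc : Continuous F := by
    have q1 := Complex.continuous_ofReal.comp (φ.continuous.comp (k1'.sub k2'))
    have q2 := Complex.continuous_ofReal.comp (ψ.continuous.comp (k2'.sub k1'))
    exact q1.add (q2.mul continuous_const)
  have Fre : ∀ z, (F z).re = φ (l₁ (c z.1) - l₂ (c z.2)) := fun z => by
    simp [F, -map_sub]
  have Fim : ∀ z, (F z).im = ψ (l₂ (c z.2) - l₁ (c z.1)) := fun z => by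
    simp [F, -map_sub]
  obtain ⟨z, hz⟩ := tis_miranda F hFc ε hε
    (fun t ht => by
      rw [Fre, hcid _ e1, hcid _ ht]
      have := abs_le.1 (est ε e1 t ht).1
      linarith [this.1])
    (fun t ht => by
      rw [Fre, hcid _ e2, hcid _ ht]
      have := abs_le.1 (est (-ε) e2 t ht).1
      linarith [this.2])
    (fun t ht => by
      rw [Fim, hcid _ e1, hcid _ ht]
      have := abs_le.1 (est t ht ε e1).2
      linarith [this.1])
    (fun t ht => by
      rw [Fim, hcid _ e2, hcid _ ht]
      have := abs_le.1 (est t ht (-ε) e2).2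
      linarith [this.2])
  have z1 := Fre z
  have z2 := Fim z
  rw [hz] at z1 z2
  have hm1 := hcm z.1
  refine ⟨c z.1, hsub hm1, c z.2, hsub (hcm z.2), ?_, ?_⟩
  · refine sub_eq_zero.1 (hinj _ z1.symm ?_)
    rw [← neg_sub, map_neg, ← z2]
    simp
  · have q1 := hc₁ _ (hsub hm1)
    have q2 := (key _ hm1).2.2.2.2.1
    calc ‖l₁ (c z.1) - p‖ = ‖(l₁ (c z.1) - r₁ (c z.1)) + (r₁ (c z.1) - p)‖ := by
          rw [sub_add_sub_cancel]
      _ ≤ _ := norm_add_le _ _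
      _ < D := by linarith
end
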